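/- Let K be a field, m ≥ 1, n ≥ 0, d ≥ 2, and let R and I = I_{m,n,d} be as in the paper's construction. Then depth(R/I) = 0 with respect to the graded maximal ideal, and consequently (via Auslander–Buchsbaum) pd_R(R/I) = m + n·M_{m,d-1}, the number of variables of R. -/

import Mathlib

open CategoryTheory MvPolynomial

/-- The projective dimension of a module `M` over `R`: the infimum, over all
projective resolutions `P` of `M`, of the length of `P` (the supremum of the
degrees where the resolution is nonzero), as an element of `ℕ∞`. -/
noncomputable def projDim (R : Type*) [CommRing R] (M : Type*) [AddCommGroup M]
    [Module R M] : ℕ∞ :=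
  sInf {c : ℕ∞ | ∃ P : ProjectiveResolution (ModuleCat.of R M),
    ∀ i : ℕ, c < i → Subsingleton (P.complex.X i)}

open Abelian Limits RingTheory.Sequence

universe u

namespace CategoryTheory.ProjectiveResolution

variable {C : Type*} [Category* C] [Abelian C]

/-- The augmentation of a projective resolution. -/
noncomputable def augmentation {Z : C} (P : ProjectiveResolution Z) : P.complex.X 0 ⟶ Z :=
  P.π.f 0

instance {Z : C} (P : ProjectiveResolution Z) : Epi P.augmentation :=
  inferInstanceAs (Epi (P.π.f 0))

lemma d_comp_augmentation {Z : C} (P : ProjectiveResolution Z) :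
    P.complex.d 1 0 ≫ P.augmentation = 0 :=
  P.complex_d_comp_π_f_zero

lemma exact_augmentation {Z : C} (P : ProjectiveResolution Z) :
    (ShortComplex.mk _ _ P.d_comp_augmentation).Exact :=
  ShortComplex.exact_of_g_is_cokernel _ P.isColimitCokernelCofork

lemma d_comp_augmentation_comp {Z W : C} (P : ProjectiveResolution Z) (f : Z ⟶ W) :
    P.complex.d 1 0 ≫ P.augmentation ≫ f = 0 := by
  rw [← Category.assoc, P.d_comp_augmentation, zero_comp]

lemma augmentation_comp_comp_eq_zero {S : ShortComplex C} (P : ProjectiveResolution S.X₁) :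
    (P.augmentation ≫ S.f) ≫ S.g = 0 := by
  rw [Category.assoc, S.zero, comp_zero]

lemma exact_augmentation_comp {S : ShortComplex C} (hS : S.ShortExact)
    (P : ProjectiveResolution S.X₁) :
    (ShortComplex.mk _ _ P.augmentation_comp_comp_eq_zero).Exact := by
  let α : ShortComplex.mk _ _ P.augmentation_comp_comp_eq_zero ⟶ S :=
    { τ₁ := P.augmentation, τ₂ := 𝟙 _, τ₃ := 𝟙 _ }
  have : Epi α.τ₁ := inferInstanceAs (Epi P.augmentation)
  have : IsIso α.τ₂ := inferInstanceAs (IsIso (𝟙 _))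
  have : Mono α.τ₃ := inferInstanceAs (Mono (𝟙 _))
  exact (ShortComplex.exact_iff_of_epi_of_isIso_of_mono α).2 hS.exact

lemma exact_d_augmentation_comp {Z W : C} (P : ProjectiveResolution Z) (f : Z ⟶ W) [Mono f] :
    (ShortComplex.mk _ _ (P.d_comp_augmentation_comp f)).Exact := by
  let α : ShortComplex.mk _ _ P.d_comp_augmentation ⟶
      ShortComplex.mk _ _ (P.d_comp_augmentation_comp f) :=
    { τ₁ := 𝟙 _, τ₂ := 𝟙 _, τ₃ := f }
  have : Epi α.τ₁ := inferInstanceAs (Epi (𝟙 _))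
  have : IsIso α.τ₂ := inferInstanceAs (IsIso (𝟙 _))
  have : Mono α.τ₃ := inferInstanceAs (Mono f)
  exact (ShortComplex.exact_iff_of_epi_of_isIso_of_mono α).1 P.exact_augmentation

/-- Splicing a projective resolution of `X₁` with a short exact sequence `0 ⟶ X₁ ⟶ X₂ ⟶ X₃ ⟶ 0`
whose middle term is projective gives a projective resolution of `X₃`. -/
noncomputable def splice {S : ShortComplex C} (hS : S.ShortExact) (h₂ : Projective S.X₂)
    (P : ProjectiveResolution S.X₁) : ProjectiveResolution S.X₃ where
  complex := P.complex.augment (P.augmentation ≫ S.f) (P.d_comp_augmentation_comp S.f)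
  projective
    | 0 => h₂
    | n + 1 => P.projective n
  π := (ChainComplex.toSingle₀Equiv _ _).symm ⟨S.g, P.augmentation_comp_comp_eq_zero⟩
  quasiIso := ⟨fun n => by
    have := hS.mono_f
    match n with
    | 0 =>
      rw [ChainComplex.quasiIsoAt₀_iff, ShortComplex.quasiIso_iff_of_zeros']
      · refine (ShortComplex.exact_and_epi_g_iff_of_iso ?_).2
          ⟨P.exact_augmentation_comp hS, hS.epi_g⟩
        exact ShortComplex.isoMk (Iso.refl _) (Iso.refl _) (Iso.refl _)
          ((Category.id_comp _).trans (Category.comp_id _).symm)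
          ((Category.id_comp _).trans
            ((ChainComplex.toSingle₀Equiv_symm_apply_f_zero (C := P.complex.augment _ _) S.g
              P.augmentation_comp_comp_eq_zero).symm.trans (Category.comp_id _).symm))
      all_goals rfl
    | 1 =>
      rw [quasiIsoAt_iff_exactAt']
      · rw [HomologicalComplex.exactAt_iff' _ 2 1 0 (by simp) (by simp)]
        exact P.exact_d_augmentation_comp S.f
      · apply ChainComplex.exactAt_succ_single_obj
    | n + 2 =>
      rw [quasiIsoAt_iff_exactAt']
      · rw [HomologicalComplex.exactAt_iff' _ (n + 3) (n + 2) (n + 1) (by simp) (by simp)]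
        exact P.exact_succ n
      · apply ChainComplex.exactAt_succ_single_obj⟩

lemma exists_isZero_of_hasProjectiveDimensionLE [EnoughProjectives C] (n : ℕ) (X : C)
    [HasProjectiveDimensionLE X n] :
    ∃ P : ProjectiveResolution X, ∀ i, n < i → IsZero (P.complex.X i) := by
  induction n generalizing X with
  | zero =>
    have := (projective_iff_hasProjectiveDimensionLE_zero _).2 ‹HasProjectiveDimensionLE X 0›
    refine ⟨.self X, fun i hi => ?_⟩
    exact HomologicalComplex.isZero_single_obj_X _ _ _ _ (by lia)
  | succ n ih =>
    let S := ShortComplex.mk (kernel.ι (Projective.π X)) (Projective.π X) (kernel.condition _)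
    have hS : S.ShortExact := { exact := ShortComplex.exact_kernel _ }
    have h₂ : Projective S.X₂ := Projective.projective_over X
    have := (hS.hasProjectiveDimensionLT_X₃_iff n h₂).1 ‹_›
    obtain ⟨P, hP⟩ := ih S.X₁
    refine ⟨.splice hS h₂ P, fun i hi => ?_⟩
    match i with
    | i + 1 => exact hP i (by lia)

lemma hasProjectiveDimensionLT_of_isZero {X : C} (P : ProjectiveResolution X) (n : ℕ)
    (hP : ∀ i, n ≤ i → IsZero (P.complex.X i)) : HasProjectiveDimensionLT X n := by
  let := HasExt.standard C
  rw [hasProjectiveDimensionLT_iff]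
  intro i hi Y x
  obtain ⟨f, hf, rfl⟩ := P.extMk_surjective x (i + 1) rfl
  obtain rfl : f = 0 := (hP i hi).eq_of_src _ _
  simp

end CategoryTheory.ProjectiveResolution

lemma projDim_eq_of_hasProjectiveDimension {R : Type*} [CommRing R]
    (M : Type*) [AddCommGroup M] [Module R M] [Small.{u_2} R] (n : ℕ)
    (hle : HasProjectiveDimensionLE (ModuleCat.of R M) n)
    (hlt : ¬ HasProjectiveDimensionLT (ModuleCat.of R M) n) :
    projDim R M = n := by
  refine le_antisymm (sInf_le ?_) (le_sInf ?_)
  · obtain ⟨P, hP⟩ :=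
      ProjectiveResolution.exists_isZero_of_hasProjectiveDimensionLE n (ModuleCat.of R M)
    exact ⟨P, fun i hi => ModuleCat.isZero_iff_subsingleton.1 (hP i (by exact_mod_cast hi))⟩
  · rintro c ⟨P, hP⟩
    by_contra! hc
    exact hlt (P.hasProjectiveDimensionLT_of_isZero n fun i hi =>
      ModuleCat.isZero_iff_subsingleton.2 (hP i (hc.trans_le (by exact_mod_cast hi))))

lemma nontrivial_ext_quotSMulTop {R : Type u} [CommRing R] (M Y : ModuleCat.{u} R) (r : R)
    (reg : IsSMulRegular M r) (hr : ∀ y : Y, r • y = 0) (k : ℕ) [Nontrivial (Ext M Y k)] :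
    Nontrivial (Ext (ModuleCat.of R (QuotSMulTop r M)) Y (k + 1)) := by
  have hS := reg.smulShortComplex_shortExact
  obtain ⟨x, hx⟩ := exists_ne (0 : Ext M Y k)
  refine ⟨hS.extClass.comp x (add_comm 1 k), 0, fun h0 => hx ?_⟩
  obtain ⟨x₂, h₂⟩ : ∃ x₂ : Ext M Y k, (Ext.mk₀ (r • 𝟙 M)).comp x₂ (zero_add k) = x :=
    Ext.contravariant_sequence_exact₁ hS Y x (add_comm 1 k) h0
  have hY : r • 𝟙 Y = 0 := by ext y; exact hr y
  rw [← h₂, Ext.mk₀_smul, Ext.smul_comp, Ext.mk₀_id_comp, ← x₂.comp_mk₀_id, ← Ext.comp_smul,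
    ← Ext.mk₀_smul, hY, Ext.mk₀_zero, Ext.comp_zero]

lemma nontrivial_ext_quotient_of_isWeaklyRegular {R : Type u} [CommRing R]
    (M Y : ModuleCat.{u} R) (rs : List R) (reg : IsWeaklyRegular M rs)
    (hrs : ∀ r ∈ rs, ∀ y : Y, r • y = 0) (k : ℕ) [Nontrivial (Ext M Y k)] :
    Nontrivial (Ext (ModuleCat.of R (M ⧸ (Ideal.ofList rs • ⊤ : Submodule R M))) Y
      (k + rs.length)) := by
  have congr_left {A B : ModuleCat.{u} R} (e : A ≅ B) (k : ℕ) [Nontrivial (Ext A Y k)] :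
      Nontrivial (Ext B Y k) := by
    have : Function.Injective fun x : Ext A Y k => (Ext.mk₀ e.inv).comp x (zero_add k) :=
      Function.LeftInverse.injective
        (g := fun x => (Ext.mk₀ e.hom).comp x (zero_add k)) fun x => by simp
    exact this.nontrivial
  induction rs generalizing M k with
  | nil =>
    exact congr_left (A := M) (Submodule.quotEquivOfEqBot _ (by simp)).symm.toModuleIso k
  | cons r rs ih =>
    rw [isWeaklyRegular_cons_iff] at reg
    have := nontrivial_ext_quotSMulTop M Y r reg.1 (hrs r (by simp)) k
    have := ih (ModuleCat.of R (QuotSMulTop r M)) reg.2 (fun s hs => hrs s (by simp [hs])) (k + 1)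
    rw [List.length_cons, add_comm rs.length, ← add_assoc]
    exact congr_left
      (Submodule.quotOfListConsSMulTopEquivQuotSMulTopInner M r rs).symm.toModuleIso _

namespace MvPolynomial

lemma X_mul_mem_span_X_image_iff {σ R : Type*} [CommRing R] {s : Set σ} {i : σ} (hi : i ∉ s)
    {f : MvPolynomial σ R} :
    X i * f ∈ Ideal.span (X '' s : Set (MvPolynomial σ R)) ↔
      f ∈ Ideal.span (X '' s : Set (MvPolynomial σ R)) := by
  refine ⟨fun h => ?_, fun h => Ideal.mul_mem_left _ _ h⟩
  rw [mem_ideal_span_X_image] at h ⊢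
  intro a ha
  obtain ⟨j, hj, hne⟩ := h (Finsupp.single i 1 + a) (by
    rw [mem_support_iff, coeff_X_mul]; exact mem_support_iff.1 ha)
  refine ⟨j, hj, ?_⟩
  have : i ≠ j := fun h => hi (h ▸ hj)
  simpa [Finsupp.single_apply, this] using hne

lemma isWeaklyRegular_map_X {σ R : Type*} [CommRing R] (l : List σ) (hl : l.Nodup) :
    IsWeaklyRegular (MvPolynomial σ R) (l.map X : List (MvPolynomial σ R)) := by
  refine ⟨fun i hi => ?_⟩
  simp only [List.length_map] at hi
  have hJ : (Ideal.ofList ((l.map X : List (MvPolynomial σ R)).take i) • ⊤ :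
      Ideal (MvPolynomial σ R)) = Ideal.span (X '' {a | a ∈ l.take i}) := by
    rw [smul_eq_mul, Ideal.mul_top, Ideal.ofList, ← List.map_take]
    congr 1
    ext; simp [-List.map_take]
  rw [isSMulRegular_quotient_iff_mem_of_smul_mem, hJ]
  intro f hf
  simp only [List.getElem_map, smul_eq_mul] at hf
  refine (X_mul_mem_span_X_image_iff ?_).1 hf
  intro (hmem : _ ∈ l.take i)
  obtain ⟨j, hj, hji⟩ := List.mem_take_iff_getElem.1 hmem
  have := (hl.getElem_inj_iff).1 hji
  lia

lemma not_hasProjectiveDimensionLT_quotient_span_X (σ : Type) [Fintype σ] (K : Type u) [Field K] :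
    ¬ HasProjectiveDimensionLT
      (ModuleCat.of (MvPolynomial σ K)
        (MvPolynomial σ K ⧸ Ideal.span (Set.range (X : σ → MvPolynomial σ K)))) (Fintype.card σ) := by
  intro h
  set R := MvPolynomial σ K
  set J : Ideal R := Ideal.span (Set.range (X : σ → R))
  let Y := ModuleCat.of R (R ⧸ J)
  have hJ : J ≠ ⊤ := by
    rw [Ne, Ideal.eq_top_iff_one]
    intro h
    have : J ≤ RingHom.ker (constantCoeff : R →+* K) := by
      rw [Ideal.span_le]
      rintro _ ⟨i, rfl⟩
      exact constantCoeff_X K i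
    simpa using this h
  let l := (Finset.univ : Finset σ).toList
  have hof : Ideal.ofList (l.map X : List R) = J := by
    simp [Ideal.ofList, J, l, Set.range]
  have : Nontrivial (R ⧸ J) := Ideal.Quotient.nontrivial_iff.2 hJ
  have h0 : Nontrivial (Ext (ModuleCat.of R R) Y 0) := by
    have : Nontrivial (ModuleCat.of R R ⟶ Y) := by
      refine ⟨ModuleCat.ofHom J.mkQ, 0, fun h => ?_⟩
      have := LinearMap.congr_fun (congrArg ModuleCat.Hom.hom h) (1 : R)
      simp at this
    exact Ext.homEquiv₀.nontrivial
  have hnt := nontrivial_ext_quotient_of_isWeaklyRegular (ModuleCat.of R R) Y (l.map X)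
    (isWeaklyRegular_map_X l (Finset.nodup_toList _)) (by
      intro r hr y
      obtain ⟨y, rfl⟩ := Ideal.Quotient.mk_surjective y
      obtain ⟨i, -, rfl⟩ := List.mem_map.1 hr
      exact Ideal.Quotient.eq_zero_iff_mem.2
        (Ideal.mul_mem_right _ _ (Ideal.subset_span ⟨i, rfl⟩))) 0
  have hJ' : (Ideal.ofList (l.map X : List R) • ⊤ : Ideal R) = J := by
    rw [hof, smul_eq_mul, Ideal.mul_top]
  have e : (R ⧸ (Ideal.ofList (l.map X : List R) • ⊤ : Ideal R)) ≃ₗ[R] (R ⧸ J) :=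
    Submodule.quotEquivOfEq _ _ hJ'
  have := hasProjectiveDimensionLT_of_iso e.symm.toModuleIso (Fintype.card σ)
  have hsub := this.subsingleton _ (Fintype.card σ) _ le_rfl Y
  simp only [zero_add, List.length_map, l, Finset.length_toList, Finset.card_univ] at hnt
  exact not_subsingleton_iff_nontrivial.2 hnt hsub

end MvPolynomial

open scoped TensorProduct Polynomial

lemma hasProjectiveDimensionLE_baseChange {A B : Type u} [CommRing A] [CommRing B] [Algebra A B]
    [Module.Flat A B] (n : ℕ) (M : ModuleCat.{u} A) [HasProjectiveDimensionLE M n] :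
    HasProjectiveDimensionLE (ModuleCat.of B (B ⊗[A] M)) n := by
  have hproj (P : ModuleCat.{u} A) (hP : Projective P) :
      Projective (ModuleCat.of B (B ⊗[A] P)) := by
    have : Module.Projective A P := (IsProjective.iff_projective P).2 hP
    exact (IsProjective.iff_projective _).1 inferInstance
  induction n generalizing M with
  | zero =>
    exact (projective_iff_hasProjectiveDimensionLE_zero _).1
      (hproj M ((projective_iff_hasProjectiveDimensionLE_zero _).2 ‹_›))
  | succ n ih =>
    let S := M.projectiveShortComplex
    have hS : S.ShortExact := M.shortExact_projectiveShortComplex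
    have h₂ : Projective S.X₂ := inferInstance
    have hex : Function.Exact S.f.hom S.g.hom :=
      (ShortComplex.ShortExact.moduleCat_exact_iff_function_exact S).1 hS.exact
    have hex' : Function.Exact (S.f.hom.baseChange B) (S.g.hom.baseChange B) :=
      Module.Flat.lTensor_exact B hex
    let S' : ShortComplex (ModuleCat.{u} B) := ModuleCat.shortComplexOfCompEqZero
      (S.f.hom.baseChange B) (S.g.hom.baseChange B) hex'.linearMap_comp_eq_zero
    have hS' : S'.ShortExact :=
      { exact := ModuleCat.shortComplex_exact _ hex'
        mono_f := (ModuleCat.mono_iff_injective _).2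
          (Module.Flat.lTensor_preserves_injective_linearMap (M := B) S.f.hom
            ((ModuleCat.mono_iff_injective _).1 hS.mono_f))
        epi_g := (ModuleCat.epi_iff_surjective _).2
          (LinearMap.lTensor_surjective B ((ModuleCat.epi_iff_surjective _).1 hS.epi_g)) }
    have := (hS.hasProjectiveDimensionLT_X₃_iff n h₂).1 ‹_›
    exact (hS'.hasProjectiveDimensionLT_X₃_iff n (hproj _ h₂)).2 (ih S.X₁)

namespace PolynomialModule

variable {A M : Type*} [CommRing A] [AddCommGroup M] [Module A M] [Module A[X] M]
  [IsScalarTower A A[X] M]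

variable (A M) in
/-- Multiplication by `X` on an `A[X]`-module, as an `A`-linear map. -/
noncomputable def mulX : M →ₗ[A] M := (LinearMap.lsmul A[X] M Polynomial.X).restrictScalars A

variable (A M) in
/-- The map `X ⊗ 1 - 1 ⊗ X` on `A[X] ⊗[A] M`, for an `A[X]`-module `M`. -/
noncomputable def charMap : A[X] ⊗[A] M →ₗ[A[X]] A[X] ⊗[A] M :=
  LinearMap.lsmul A[X] _ Polynomial.X - (mulX A M).baseChange A[X]

variable (A M) in
/-- The action map `A[X] ⊗[A] M → M`, for an `A[X]`-module `M`. -/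
noncomputable def actionMap : A[X] ⊗[A] M →ₗ[A[X]] M :=
  LinearMap.liftBaseChange A[X] LinearMap.id

lemma charMap_tmul (p : A[X]) (m : M) :
    charMap A M (p ⊗ₜ m) = (Polynomial.X * p) ⊗ₜ m - p ⊗ₜ ((Polynomial.X : A[X]) • m) := by
  simp [charMap, mulX, TensorProduct.smul_tmul']

lemma actionMap_tmul (p : A[X]) (m : M) : actionMap A M (p ⊗ₜ m) = p • m := by
  simp [actionMap]

lemma actionMap_surjective : Function.Surjective (actionMap A M) := fun m =>
  ⟨1 ⊗ₜ m, by simp [actionMap_tmul]⟩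

lemma actionMap_comp_charMap : actionMap A M ∘ₗ charMap A M = 0 := by
  ext m
  simp [charMap_tmul, actionMap_tmul]

lemma sub_one_tmul_actionMap_mem_range (z : A[X] ⊗[A] M) :
    z - 1 ⊗ₜ actionMap A M z ∈ LinearMap.range (charMap A M) := by
  induction z with
  | zero => simp
  | add x y hx hy =>
    rw [map_add, TensorProduct.tmul_add, add_sub_add_comm]
    exact add_mem hx hy
  | tmul p m =>
    rw [actionMap_tmul]
    induction p using Polynomial.induction_on' with
    | add p q hp hq =>
      rw [TensorProduct.add_tmul, add_smul, TensorProduct.tmul_add, add_sub_add_comm]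
      exact add_mem hp hq
    | monomial n a =>
      induction n generalizing m with
      | zero =>
        have : (Polynomial.monomial 0 a : A[X]) = a • 1 := by
          simp [Polynomial.smul_eq_C_mul]
        rw [this, TensorProduct.smul_tmul, smul_assoc, one_smul, sub_self]
        exact zero_mem _
      | succ n ih =>
        have hX : (Polynomial.monomial (n + 1) a : A[X]) =
            Polynomial.X * Polynomial.monomial n a := by
          rw [Polynomial.X_mul_monomial]
        have h := add_mem (LinearMap.mem_range_self (charMap A M) (Polynomial.monomial n a ⊗ₜ m))
          (ih ((Polynomial.X : A[X]) • m))
        rw [charMap_tmul, ← hX, sub_add_sub_cancel, smul_smul, mul_comm, ← hX] at h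
        exact h

lemma exact_charMap_actionMap : Function.Exact (charMap A M) (actionMap A M) := by
  intro z
  refine ⟨fun hz => ?_, ?_⟩
  · simpa [hz] using sub_one_tmul_actionMap_mem_range z
  · rintro ⟨w, rfl⟩
    exact LinearMap.congr_fun actionMap_comp_charMap w

lemma charMap_injective : Function.Injective (charMap A M) := by
  obtain ⟨e, he⟩ : ∃ e : A[X] ⊗[A] M ≃ₗ[A[X]] PolynomialModule A M,
      ∀ p m, e (p ⊗ₜ m) = p • single A 0 m :=
    ⟨polynomialTensorProductLEquivPolynomialModule A M, fun _ _ => rfl⟩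
  have hT (z : A[X] ⊗[A] M) (n : ℕ) : (e ((mulX A M).baseChange A[X] z)).coeff n =
      (Polynomial.X : A[X]) • (e z).coeff n := by
    induction z with
    | zero => simp
    | add x y hx hy => simp [hx, hy]
    | tmul p m =>
      rw [LinearMap.baseChange_tmul, he, he, smul_single_apply, smul_single_apply]
      exact smul_comm _ _ _
  rw [injective_iff_map_eq_zero]
  intro z hz
  have hz' (n : ℕ) : (e z).coeff n = (Polynomial.X : A[X]) • (e z).coeff (n + 1) := by
    have h1 : (Polynomial.X : A[X]) • z = (mulX A M).baseChange A[X] z := by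
      rw [charMap, LinearMap.sub_apply, sub_eq_zero] at hz
      exact hz
    rw [← hT, ← h1, e.map_smul]
    have := monomial_smul_apply 1 (1 : A) (e z) (n + 1)
    rw [Polynomial.monomial_one_one_eq_X] at this
    simpa using this.symm
  have hpow (n k : ℕ) : (e z).coeff n = (Polynomial.X ^ k : A[X]) • (e z).coeff (n + k) := by
    induction k with
    | zero => simp
    | succ k ih => rw [ih, hz' (n + k), smul_smul, pow_succ, add_assoc]
  rw [← e.map_eq_zero_iff, ← coeff_eq_zero]
  ext n
  obtain ⟨N, hN⟩ := (e z).coeff.support.bddAbove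
  rw [hpow n (N + 1), Finsupp.notMem_support_iff.1 (fun h => by have := hN h; lia), smul_zero]
  rfl

end PolynomialModule

/-- Every module over `R` has projective dimension at most `n`. -/
def GlobalDimensionLE (R : Type u) [CommRing R] (n : ℕ) : Prop :=
  ∀ M : ModuleCat.{u} R, HasProjectiveDimensionLE M n

namespace GlobalDimensionLE

lemma of_field (K : Type u) [Field K] : GlobalDimensionLE K 0 := fun M =>
  (projective_iff_hasProjectiveDimensionLE_zero _).1 (ModuleCat.projective_of_free
    (Module.Free.chooseBasis K M))

lemma of_ringEquiv {R S : Type u} [CommRing R] [CommRing S] (e : R ≃+* S) {n : ℕ}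
    (h : GlobalDimensionLE R n) : GlobalDimensionLE S n := fun M => by
  have := RingHomInvPair.of_ringEquiv e
  have := RingHomInvPair.of_ringEquiv e.symm
  let N := (ModuleCat.restrictScalars.{u} e.toRingHom).obj M
  have : HasProjectiveDimensionLE N n := h N
  let e' : N ≃ₛₗ[RingHomClass.toRingHom e] M :=
    { toFun := fun x => x
      invFun := fun x => x
      map_add' := fun _ _ => rfl
      map_smul' := fun _ _ => rfl
      left_inv := fun _ => rfl
      right_inv := fun _ => rfl }
  exact ModuleCat.hasProjectiveDimensionLE_of_semiLinearEquiv e e' n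

lemma polynomial {A : Type u} [CommRing A] {n : ℕ} (h : GlobalDimensionLE A n) :
    GlobalDimensionLE A[X] (n + 1) := fun M => by
  let := Module.compHom M (Polynomial.C : A →+* A[X])
  have : IsScalarTower A A[X] M := ⟨fun a p m => by
    rw [Polynomial.smul_eq_C_mul, mul_smul]; rfl⟩
  let N := ModuleCat.of A M
  have : HasProjectiveDimensionLE N n := h N
  have hN : HasProjectiveDimensionLE (ModuleCat.of A[X] (A[X] ⊗[A] M)) n :=
    hasProjectiveDimensionLE_baseChange n N
  let S : ShortComplex (ModuleCat.{u} A[X]) := ModuleCat.shortComplexOfCompEqZero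
    (PolynomialModule.charMap A M) (PolynomialModule.actionMap A M)
    PolynomialModule.actionMap_comp_charMap
  have hS : S.ShortExact :=
    { exact := ModuleCat.shortComplex_exact _ PolynomialModule.exact_charMap_actionMap
      mono_f := (ModuleCat.mono_iff_injective _).2 PolynomialModule.charMap_injective
      epi_g := (ModuleCat.epi_iff_surjective _).2 PolynomialModule.actionMap_surjective }
  exact hS.hasProjectiveDimensionLT_X₃ (n + 1) hN
    (hasProjectiveDimensionLT_of_ge (ModuleCat.of A[X] (A[X] ⊗[A] M)) (n + 1) (n + 2) (by lia))

/-- Hilbert's syzygy theorem. -/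
lemma mvPolynomial_fin (K : Type u) [Field K] (n : ℕ) :
    GlobalDimensionLE (MvPolynomial (Fin n) K) n := by
  induction n with
  | zero => exact (of_field K).of_ringEquiv (MvPolynomial.isEmptyRingEquiv K (Fin 0)).symm
  | succ n ih => exact ih.polynomial.of_ringEquiv (MvPolynomial.finSuccEquiv K n).symm.toRingEquiv

/-- Hilbert's syzygy theorem. -/
lemma mvPolynomial (σ : Type) [Fintype σ] (K : Type u) [Field K] :
    GlobalDimensionLE (MvPolynomial σ K) (Fintype.card σ) :=
  (mvPolynomial_fin K (Fintype.card σ)).of_ringEquiv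
    (MvPolynomial.renameEquiv K (Fintype.equivFin σ).symm).toRingEquiv

end GlobalDimensionLE

/-- Over a ring of global dimension at most `n`, if `R ⧸ J` has projective dimension `n` and `J` is
the annihilator of an element of `M`, then `M` has projective dimension at least `n`. -/
lemma GlobalDimensionLE.not_hasProjectiveDimensionLT_of_ker {R : Type u} [CommRing R] {n : ℕ}
    (hR : GlobalDimensionLE R n) {J : Ideal R}
    (hJ : ¬ HasProjectiveDimensionLT (ModuleCat.of R (R ⧸ J)) n)
    {M : Type u} [AddCommGroup M] [Module R M] (t : M)
    (ht : LinearMap.ker (LinearMap.toSpanSingleton R M t) = J) :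
    ¬ HasProjectiveDimensionLT (ModuleCat.of R M) n := by
  intro h
  let f : (R ⧸ J) →ₗ[R] M := J.liftQ (LinearMap.toSpanSingleton R M t) ht.ge
  have hf : Function.Injective f := LinearMap.ker_eq_bot.1
    (Submodule.ker_liftQ_eq_bot _ _ _ ht.le)
  let S : ShortComplex (ModuleCat.{u} R) := ModuleCat.shortComplexOfCompEqZero f
    (LinearMap.range f).mkQ (LinearMap.range_mkQ_comp f)
  have hS : S.ShortExact :=
    { exact := ModuleCat.shortComplex_exact _ (LinearMap.exact_map_mkQ_range f)
      mono_f := (ModuleCat.mono_iff_injective _).2 hf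
      epi_g := (ModuleCat.epi_iff_surjective _).2 (Submodule.mkQ_surjective _) }
  exact hJ (hS.hasProjectiveDimensionLT_X₁ n h (hR S.X₃))

namespace MvPolynomial

/-- An element that is annihilated modulo `I` by all the variables, but does not lie in `I`, has
annihilator the ideal of the variables. -/
lemma mul_mem_iff_mem_span_range_X {σ K : Type*} [Field K] {I : Ideal (MvPolynomial σ K)}
    {s : MvPolynomial σ K} (hs : s ∉ I) (hX : ∀ i, X i * s ∈ I) (f : MvPolynomial σ K) :
    f * s ∈ I ↔ f ∈ Ideal.span (Set.range (X : σ → MvPolynomial σ K)) := by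
  have hle {g : MvPolynomial σ K} (hg : g ∈ Ideal.span (Set.range X)) : g * s ∈ I := by
    have : Ideal.span (Set.range (X : σ → MvPolynomial σ K)) ≤
        Submodule.comap (LinearMap.toSpanSingleton (MvPolynomial σ K) _ s) I := by
      rw [Ideal.span_le]
      rintro _ ⟨i, rfl⟩
      exact hX i
    exact this hg
  refine ⟨fun hf => ?_, hle⟩
  have hsub : f - C (constantCoeff f) ∈ Ideal.span (Set.range (X : σ → MvPolynomial σ K)) := by
    rw [← Set.image_univ, mem_ideal_span_X_image]
    intro a ha
    by_contra! h
    obtain rfl : a = 0 := by ext i; simpa using h i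
    simp [constantCoeff_eq] at ha
  have hc : C (constantCoeff f) * s ∈ I := by
    have := sub_mem hf (hle hsub)
    rwa [← sub_mul, sub_sub_cancel] at this
  have h0 : constantCoeff f = 0 := by
    by_contra h
    refine hs ?_
    have := I.mul_mem_left (C (constantCoeff f)⁻¹) hc
    rwa [← mul_assoc, ← C_mul, inv_mul_cancel₀ h, C_1, one_mul] at this
  simpa [h0] using hsub

end MvPolynomial

section

variable {K : Type*} [Field K] {m n d p : ℕ}

/-- The ideal generated by the powers `X_i ^ d` and the forms `∑ j, Z_j Y_{j,k}`. -/
noncomputable def powerFormIdeal (K : Type*) [Field K] (n d : ℕ) {m p : ℕ} (Z : Fin p → Fin m →₀ ℕ) :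
    Ideal (MvPolynomial (Fin m ⊕ Fin p × Fin n) K) :=
  Ideal.span
    ((Set.range fun i : Fin m => (X (Sum.inl i) : MvPolynomial (Fin m ⊕ Fin p × Fin n) K) ^ d) ∪
     (Set.range fun k : Fin n => ∑ j : Fin p,
      monomial (Finsupp.mapDomain Sum.inl (Z j)) 1 * X (Sum.inr (j, k))))

/-- The exponent `(d - 1, …, d - 1)`. -/
noncomputable def topExponent (m d : ℕ) : Fin m →₀ ℕ := Finsupp.equivFunOnFinite.symm fun _ => d - 1

lemma topExponent_apply (i : Fin m) : topExponent m d i = d - 1 := rfl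

/-- The monomial `∏ X_i ^ (d - 1)`. -/
noncomputable def socleElement (K : Type*) [Field K] (m n d p : ℕ) :
    MvPolynomial (Fin m ⊕ Fin p × Fin n) K :=
  monomial (Finsupp.mapDomain Sum.inl (topExponent m d)) 1

lemma monomial_mem_powerFormIdeal {Z : Fin p → Fin m →₀ ℕ} {a : Fin m →₀ ℕ} {i : Fin m}
    (h : d ≤ a i) :
    monomial (Finsupp.mapDomain Sum.inl a) (1 : K) ∈ powerFormIdeal K n d Z := by
  have hX : (X (Sum.inl i) : MvPolynomial (Fin m ⊕ Fin p × Fin n) K) ^ d ∈ powerFormIdeal K n d Z :=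
    Ideal.subset_span (Or.inl ⟨i, rfl⟩)
  refine Ideal.mem_of_dvd _ ?_ hX
  rw [X_pow_eq_monomial, monomial_dvd_monomial]
  refine ⟨Or.inr ?_, dvd_rfl⟩
  rw [Finsupp.single_le_iff, Finsupp.mapDomain_apply Sum.inl_injective]
  exact h

lemma X_mul_socleElement_mem (hd : 2 ≤ d) {Z : Fin p → Fin m →₀ ℕ} (hZinj : Function.Injective Z)
    (hZdeg : ∀ j, ((Z j).sum fun _ k => k) = d - 1) (v : Fin m ⊕ Fin p × Fin n) :
    X v * socleElement K m n d p ∈ powerFormIdeal K n d Z := by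
  match v with
  | .inl i =>
    rw [socleElement, X, monomial_mul, one_mul, ← Finsupp.mapDomain_single,
      ← Finsupp.mapDomain_add]
    refine monomial_mem_powerFormIdeal (i := i) ?_
    simp [topExponent_apply]
    lia
  | .inr (j, k) =>
    have hZle : Z j ≤ topExponent m d := fun i => by
      rw [topExponent_apply, ← hZdeg j]
      by_cases hi : i ∈ (Z j).support
      · exact Finset.single_le_sum (f := fun i => Z j i) (fun _ _ => Nat.zero_le _) hi
      · simp [Finsupp.notMem_support_iff.1 hi]
    have hf : monomial (Finsupp.mapDomain Sum.inl (topExponent m d - Z j)) (1 : K) *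
        ∑ j' : Fin p, monomial (Finsupp.mapDomain Sum.inl (Z j')) 1 * X (Sum.inr (j', k)) ∈
        powerFormIdeal K n d Z :=
      Ideal.mul_mem_left _ _ (Ideal.subset_span (Or.inr ⟨k, rfl⟩))
    rw [Finset.mul_sum, ← Finset.add_sum_erase _ _ (Finset.mem_univ j),
      Ideal.add_mem_iff_left, ← mul_assoc, monomial_mul, ← Finsupp.mapDomain_add,
      tsub_add_cancel_of_le hZle, one_mul, mul_comm] at hf
    · exact hf
    · refine Ideal.sum_mem _ fun j' hj' => ?_
      rw [← mul_assoc, monomial_mul, ← Finsupp.mapDomain_add, one_mul]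
      refine Ideal.mul_mem_right _ _ ?_
      obtain ⟨i, hi⟩ : ∃ i, Z j i < Z j' i := by
        by_contra! h
        refine (Finset.ne_of_mem_erase hj') (hZinj ?_)
        have hsum := (hZdeg j').trans (hZdeg j).symm
        rw [Finsupp.sum_fintype _ _ (by simp), Finsupp.sum_fintype _ _ (by simp)] at hsum
        ext i
        exact (Finset.sum_eq_sum_iff_of_le fun i _ => h i).1 hsum i (Finset.mem_univ _)
      refine monomial_mem_powerFormIdeal (i := i) ?_
      have := hZle i
      simp only [Finsupp.coe_add, Finsupp.coe_tsub, Pi.add_apply, Pi.sub_apply,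
        topExponent_apply] at this ⊢
      lia

lemma socleElement_notMem (hd : 2 ≤ d) (Z : Fin p → Fin m →₀ ℕ) :
    socleElement K m n d p ∉ powerFormIdeal K n d Z := by
  intro h
  let φ : MvPolynomial (Fin m ⊕ Fin p × Fin n) K →ₐ[K] MvPolynomial (Fin m) K :=
    aeval (Sum.elim X 0)
  have hφ : powerFormIdeal K n d Z ≤ Ideal.comap φ
      (Ideal.span ((fun a => monomial a (1 : K)) '' Set.range fun i : Fin m =>
        Finsupp.single i d)) := by
    rw [powerFormIdeal, Ideal.span_le]
    rintro _ (⟨i, rfl⟩ | ⟨k, rfl⟩)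
    · refine Ideal.subset_span ⟨_, ⟨i, rfl⟩, ?_⟩
      rw [map_pow, aeval_X, Sum.elim_inl, X_pow_eq_monomial]
    · simp [φ]
  have hs : φ (socleElement K m n d p) = monomial (topExponent m d) 1 := by
    rw [socleElement, ← rename_monomial]
    simp only [φ, aeval_rename]
    exact aeval_X_left_apply _
  have := hφ h
  rw [Ideal.mem_comap, hs, mem_ideal_span_monomial_image] at this
  obtain ⟨_, ⟨i, rfl⟩, hi⟩ := this (topExponent m d) (by simp [mem_support_iff])
  rw [Finsupp.single_le_iff, topExponent_apply] at hi
  lia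

end

/-- Main theorem: with `R` and `I = I_{m,n,d}` as in the paper's construction,
the depth of `R/I` is zero (i.e. `R/I ≠ 0` and every element of the graded
maximal ideal is a zerodivisor on `R/I`), and consequently, via
Auslander–Buchsbaum, `pd_R(R/I) = m + n·p = m + n·M_{m,d-1}`, the number of
variables of `R`. -/
theorem depth_zero_and_pd (K : Type*) [Field K] (m n d p : ℕ)
    (hm : 1 ≤ m) (hd : 2 ≤ d) (hp : p = Nat.choose (m + d - 2) (d - 1))
    (Z : Fin p → (Fin m →₀ ℕ)) (hZinj : Function.Injective Z)
    (hZdeg : ∀ j, ((Z j).sum fun _ k => k) = d - 1)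
    (hZsurj : ∀ e : Fin m →₀ ℕ, (e.sum fun _ k => k) = d - 1 → ∃ j, Z j = e) :
    let R := MvPolynomial (Fin m ⊕ Fin p × Fin n) K
    let Zpoly : Fin p → R := fun j => monomial (Finsupp.mapDomain Sum.inl (Z j)) 1
    let I : Ideal R := Ideal.span
      ((Set.range fun i : Fin m => (X (Sum.inl i) : R) ^ d) ∪
       (Set.range fun k : Fin n => ∑ j : Fin p, Zpoly j * X (Sum.inr (j, k))))
    (Nontrivial (R ⧸ I) ∧
      ∀ r ∈ Ideal.span (Set.range (X : Fin m ⊕ Fin p × Fin n → R)),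
        ∃ t : R ⧸ I, t ≠ 0 ∧ r • t = 0) ∧
    projDim R (R ⧸ I) = (m + n * p : ℕ) := by
  intro R Zpoly I
  have hs : socleElement K m n d p ∉ I := socleElement_notMem hd Z
  have hX (v) : X v * socleElement K m n d p ∈ I := X_mul_socleElement_mem hd hZinj hZdeg v
  have hne : Ideal.Quotient.mk I (socleElement K m n d p) ≠ 0 := fun h =>
    hs (Ideal.Quotient.eq_zero_iff_mem.1 h)
  refine ⟨⟨⟨_, _, hne⟩, fun r hr => ⟨_, hne, ?_⟩⟩, ?_⟩
  · exact Ideal.Quotient.eq_zero_iff_mem.2 ((mul_mem_iff_mem_span_range_X hs hX r).2 hr)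
  · have hcard : Fintype.card (Fin m ⊕ Fin p × Fin n) = m + n * p := by
      simp [mul_comm]
    have hR : GlobalDimensionLE R (m + n * p) := hcard ▸ GlobalDimensionLE.mvPolynomial _ K
    refine projDim_eq_of_hasProjectiveDimension _ _ (hR _)
      (hR.not_hasProjectiveDimensionLT_of_ker (hcard ▸
        not_hasProjectiveDimensionLT_quotient_span_X (Fin m ⊕ Fin p × Fin n) K)
        (Ideal.Quotient.mk I (socleElement K m n d p)) ?_)
    ext r
    rw [← mul_mem_iff_mem_span_range_X hs hX r]
    exact Ideal.Quotient.eq_zero_iff_mem
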